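/- Let E be an associative unital k-algebra. If u : C1 → E and v : C2 → E are convolution invertible with convolution inverses u⁻¹ and v⁻¹, then μ_E∘(u⊗v) : C1⊗_cC2 → E is convolution invertible with respect to the comultiplication Δ_{C1⊗_cC2} = (id_{C1}⊗c⊗id_{C2})∘(Δ_1⊗Δ_2) and counit ε_1⊗ε_2, and its convolution inverse is μ_E∘(v⁻¹⊗u⁻¹)∘c; explicitly, setting f := μ_E∘(u⊗v) and g := μ_E∘(v⁻¹⊗u⁻¹)∘c one has μ_E∘(f⊗g)∘(id_{C1}⊗c⊗id_{C2})∘(Δ_1⊗Δ_2) = η_E∘(ε_1⊗ε_2) = μ_E∘(g⊗f)∘(id_{C1}⊗c⊗id_{C2})∘(Δ_1⊗Δ_2). -/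

import Mathlib

/-!
If `u : C1 → E` and `v : C2 → E` are convolution invertible linear maps into an algebra `E`,
then `μ_E∘(u⊗v) : C1⊗_cC2 → E` is convolution invertible with convolution inverse
`μ_E∘(v⁻¹⊗u⁻¹)∘c`, with respect to the comultiplication `(id⊗c⊗id)∘(Δ₁⊗Δ₂)` and counit
`ε₁⊗ε₂` of `C1⊗_cC2`.
-/

open scoped TensorProduct

universe u

variable {k : Type u} [Field k]
variable {C1 : Type u} [AddCommGroup C1] [Module k C1] [Coalgebra k C1]
variable {C2 : Type u} [AddCommGroup C2] [Module k C2] [Coalgebra k C2]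

/-- `c` is compatible with the coalgebra structure of `C1`:
`(id_{C2}⊗ε₁)∘c = ε₁⊗id_{C2}` and `(id_{C2}⊗Δ₁)∘c = (c⊗id_{C1})∘(id_{C1}⊗c)∘(Δ₁⊗id_{C2})`. -/
def CompatFirst (c : C1 ⊗[k] C2 →ₗ[k] C2 ⊗[k] C1) : Prop :=
  ((TensorProduct.rid k C2).toLinearMap
      ∘ₗ LinearMap.lTensor C2 (Coalgebra.counit (R := k) (A := C1)) ∘ₗ c
    = (TensorProduct.lid k C2).toLinearMap
      ∘ₗ LinearMap.rTensor C2 (Coalgebra.counit (R := k) (A := C1))) ∧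
  (LinearMap.lTensor C2 (Coalgebra.comul (R := k) (A := C1)) ∘ₗ c
    = (TensorProduct.assoc k C2 C1 C1).toLinearMap
      ∘ₗ LinearMap.rTensor C1 c
      ∘ₗ (TensorProduct.assoc k C1 C2 C1).symm.toLinearMap
      ∘ₗ LinearMap.lTensor C1 c
      ∘ₗ (TensorProduct.assoc k C1 C1 C2).toLinearMap
      ∘ₗ LinearMap.rTensor C2 (Coalgebra.comul (R := k) (A := C1)))

/-- `c` is compatible with the coalgebra structure of `C2`:
`(ε₂⊗id_{C1})∘c = id_{C1}⊗ε₂` and `(Δ₂⊗id_{C1})∘c = (id_{C2}⊗c)∘(c⊗id_{C2})∘(id_{C1}⊗Δ₂)`. -/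
def CompatSecond (c : C1 ⊗[k] C2 →ₗ[k] C2 ⊗[k] C1) : Prop :=
  ((TensorProduct.lid k C1).toLinearMap
      ∘ₗ LinearMap.rTensor C1 (Coalgebra.counit (R := k) (A := C2)) ∘ₗ c
    = (TensorProduct.rid k C1).toLinearMap
      ∘ₗ LinearMap.lTensor C1 (Coalgebra.counit (R := k) (A := C2))) ∧
  ((TensorProduct.assoc k C2 C2 C1).toLinearMap
      ∘ₗ LinearMap.rTensor C1 (Coalgebra.comul (R := k) (A := C2)) ∘ₗ c
    = LinearMap.lTensor C2 c
      ∘ₗ (TensorProduct.assoc k C2 C1 C2).toLinearMap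
      ∘ₗ LinearMap.rTensor C2 c
      ∘ₗ (TensorProduct.assoc k C1 C2 C2).symm.toLinearMap
      ∘ₗ LinearMap.lTensor C1 (Coalgebra.comul (R := k) (A := C2)))

/-- The comultiplication `Δ_{C1⊗_cC2} := (id_{C1}⊗c⊗id_{C2})∘(Δ₁⊗Δ₂)` on `C1⊗C2`. -/
noncomputable def comulD (c : C1 ⊗[k] C2 →ₗ[k] C2 ⊗[k] C1) :
    (C1 ⊗[k] C2) →ₗ[k] (C1 ⊗[k] C2) ⊗[k] (C1 ⊗[k] C2) :=
  (TensorProduct.assoc k C1 C2 (C1 ⊗[k] C2)).symm.toLinearMap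
    ∘ₗ LinearMap.lTensor C1 (TensorProduct.assoc k C2 C1 C2).toLinearMap
    ∘ₗ LinearMap.lTensor C1 (LinearMap.rTensor C2 c)
    ∘ₗ LinearMap.lTensor C1 (TensorProduct.assoc k C1 C2 C2).symm.toLinearMap
    ∘ₗ (TensorProduct.assoc k C1 C1 (C2 ⊗[k] C2)).toLinearMap
    ∘ₗ TensorProduct.map (Coalgebra.comul (R := k) (A := C1))
        (Coalgebra.comul (R := k) (A := C2))

/-- The counit `ε₁⊗ε₂` on `C1⊗C2`. -/
noncomputable def counitD : (C1 ⊗[k] C2) →ₗ[k] k :=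
  (TensorProduct.lid k k).toLinearMap
    ∘ₗ TensorProduct.map (Coalgebra.counit (R := k) (A := C1))
        (Coalgebra.counit (R := k) (A := C2))


variable {E : Type u} [Ring E] [Algebra k E]

omit [Coalgebra k C1] in
open LinearMap in
/-- If `v ∗ v' = η ∘ ε₂`, then `(v ⊗ v' ⊗ w) ∘ (id ⊗ c) ∘ (c ⊗ id) ∘ (id ⊗ Δ₂)`, multiplied out in `E`,
is `w ⊗ ε₂`. -/
theorem CompatSecond.mul_map_comul {c : C1 ⊗[k] C2 →ₗ[k] C2 ⊗[k] C1} (h : CompatSecond c)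
    (w : C1 →ₗ[k] E) {v v' : C2 →ₗ[k] E}
    (hv : mul' k E ∘ₗ TensorProduct.map v v' ∘ₗ (Coalgebra.comul (R := k) (A := C2))
      = Algebra.linearMap k E ∘ₗ (Coalgebra.counit (R := k) (A := C2))) (x : C1) (y : C2) :
    mul' k E (TensorProduct.map v (mul' k E ∘ₗ TensorProduct.map v' w ∘ₗ c)
      (TensorProduct.assoc k C2 C1 C2 (rTensor C2 c
        ((TensorProduct.assoc k C1 C2 C2).symm (x ⊗ₜ[k] Coalgebra.comul (R := k) y)))))
      = w x * algebraMap k E (Coalgebra.counit (R := k) y) := by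
  have collapse : ∀ z : C2 ⊗[k] C1,
      mul' k E (TensorProduct.map v (mul' k E ∘ₗ TensorProduct.map v' w)
        (TensorProduct.assoc k C2 C2 C1 (rTensor C1 (Coalgebra.comul (R := k) (A := C2)) z)))
        = w (TensorProduct.lid k C1 (rTensor C1 (Coalgebra.counit (R := k) (A := C2)) z)) := by
    intro z
    induction z with
    | zero => simp
    | add a b ha hb => simp only [map_add, ha, hb]
    | tmul p b =>
      have hp : mul' k E (TensorProduct.map v v' (Coalgebra.comul (R := k) p))
          = algebraMap k E (Coalgebra.counit (R := k) p) := LinearMap.congr_fun hv p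
      have assoc_mul : ∀ t : C2 ⊗[k] C2,
          mul' k E (TensorProduct.map v (mul' k E ∘ₗ TensorProduct.map v' w)
            (TensorProduct.assoc k C2 C2 C1 (t ⊗ₜ[k] b)))
            = mul' k E (TensorProduct.map v v' t) * w b := by
        intro t
        induction t with
        | zero => simp
        | add a b ha hb => simp only [map_add, TensorProduct.add_tmul, ha, hb, add_mul]
        | tmul p q => simp [mul_assoc]
      rw [rTensor_tmul, assoc_mul, hp]
      simp [Algebra.smul_def]
  have hc := LinearMap.congr_fun h.2 (x ⊗ₜ[k] y)
  have hε := LinearMap.congr_fun h.1 (x ⊗ₜ[k] y)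
  simp only [coe_comp, LinearEquiv.coe_coe, Function.comp_apply, lTensor_tmul,
    TensorProduct.rid_tmul] at hc hε
  have key := collapse (c (x ⊗ₜ[k] y))
  rw [hc, hε, map_smul, Algebra.smul_def, Algebra.commutes] at key
  rw [← key, ← comp_apply (TensorProduct.map _ _) (lTensor C2 c), map_comp_lTensor, comp_assoc]

omit [Coalgebra k C2] in
open LinearMap in
/-- If `u' ∗ u = η ∘ ε₁`, then `(w ⊗ u' ⊗ u) ∘ (c ⊗ id) ∘ (id ⊗ c) ∘ (Δ₁ ⊗ id)`, multiplied out in `E`,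
is `ε₁ ⊗ w`. -/
theorem CompatFirst.mul_map_comul {c : C1 ⊗[k] C2 →ₗ[k] C2 ⊗[k] C1} (h : CompatFirst c)
    (w : C2 →ₗ[k] E) {u u' : C1 →ₗ[k] E}
    (hu : mul' k E ∘ₗ TensorProduct.map u' u ∘ₗ (Coalgebra.comul (R := k) (A := C1))
      = Algebra.linearMap k E ∘ₗ (Coalgebra.counit (R := k) (A := C1))) (x : C1) (y : C2) :
    mul' k E (TensorProduct.map (mul' k E ∘ₗ TensorProduct.map w u' ∘ₗ c) u
      ((TensorProduct.assoc k C1 C2 C1).symm (lTensor C1 c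
        (TensorProduct.assoc k C1 C1 C2 (Coalgebra.comul (R := k) x ⊗ₜ[k] y)))))
      = algebraMap k E (Coalgebra.counit (R := k) x) * w y := by
  have collapse : ∀ z : C2 ⊗[k] C1,
      mul' k E (TensorProduct.map (mul' k E ∘ₗ TensorProduct.map w u') u
        ((TensorProduct.assoc k C2 C1 C1).symm
          (lTensor C2 (Coalgebra.comul (R := k) (A := C1)) z)))
        = w (TensorProduct.rid k C2 (lTensor C2 (Coalgebra.counit (R := k) (A := C1)) z)) := by
    intro z
    induction z with
    | zero => simp
    | add a b ha hb => simp only [map_add, ha, hb]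
    | tmul q a =>
      have ha : mul' k E (TensorProduct.map u' u (Coalgebra.comul (R := k) a))
          = algebraMap k E (Coalgebra.counit (R := k) a) := LinearMap.congr_fun hu a
      have assoc_mul : ∀ t : C1 ⊗[k] C1,
          mul' k E (TensorProduct.map (mul' k E ∘ₗ TensorProduct.map w u') u
            ((TensorProduct.assoc k C2 C1 C1).symm (q ⊗ₜ[k] t)))
            = w q * mul' k E (TensorProduct.map u' u t) := by
        intro t
        induction t with
        | zero => simp
        | add a b ha hb => simp only [map_add, TensorProduct.tmul_add, ha, hb, mul_add]
        | tmul p q => simp [mul_assoc]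
      rw [lTensor_tmul, assoc_mul, ha, ← Algebra.commutes]
      simp [Algebra.smul_def]
  have hc := LinearMap.congr_fun h.2 (x ⊗ₜ[k] y)
  have hε := LinearMap.congr_fun h.1 (x ⊗ₜ[k] y)
  simp only [coe_comp, LinearEquiv.coe_coe, Function.comp_apply, rTensor_tmul,
    TensorProduct.lid_tmul] at hc hε
  have key := collapse (c (x ⊗ₜ[k] y))
  rw [hc, hε, map_smul, Algebra.smul_def, LinearEquiv.symm_apply_apply] at key
  rw [← key, ← comp_apply (TensorProduct.map _ _) (rTensor C1 c), map_comp_rTensor, comp_assoc]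

open LinearMap in
/-- The middle part `(id⊗c⊗id)` of `comulD c`, with its reassociations. -/
noncomputable def middleBraid (c : C1 ⊗[k] C2 →ₗ[k] C2 ⊗[k] C1) :
    (C1 ⊗[k] C1) ⊗[k] (C2 ⊗[k] C2) →ₗ[k] (C1 ⊗[k] C2) ⊗[k] (C1 ⊗[k] C2) :=
  (TensorProduct.assoc k C1 C2 (C1 ⊗[k] C2)).symm.toLinearMap
    ∘ₗ lTensor C1 (TensorProduct.assoc k C2 C1 C2).toLinearMap
    ∘ₗ lTensor C1 (rTensor C2 c)
    ∘ₗ lTensor C1 (TensorProduct.assoc k C1 C2 C2).symm.toLinearMap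
    ∘ₗ (TensorProduct.assoc k C1 C1 (C2 ⊗[k] C2)).toLinearMap

theorem comulD_tmul (c : C1 ⊗[k] C2 →ₗ[k] C2 ⊗[k] C1) (x : C1) (y : C2) :
    comulD c (x ⊗ₜ[k] y)
      = middleBraid c (Coalgebra.comul (R := k) x ⊗ₜ[k] Coalgebra.comul (R := k) y) := rfl

omit [Coalgebra k C1] [Coalgebra k C2] in
open LinearMap in
theorem mul_map_middleBraid_left (c : C1 ⊗[k] C2 →ₗ[k] C2 ⊗[k] C1)
    (u : C1 →ₗ[k] E) (v : C2 →ₗ[k] E) (g : C1 ⊗[k] C2 →ₗ[k] E) (a b : C1) (t : C2 ⊗[k] C2) :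
    mul' k E (TensorProduct.map (mul' k E ∘ₗ TensorProduct.map u v) g
      (middleBraid c ((a ⊗ₜ[k] b) ⊗ₜ[k] t)))
      = u a * mul' k E (TensorProduct.map v g
        (TensorProduct.assoc k C2 C1 C2 (rTensor C2 c
          ((TensorProduct.assoc k C1 C2 C2).symm (b ⊗ₜ[k] t))))) := by
  simp only [middleBraid, coe_comp, LinearEquiv.coe_coe, Function.comp_apply,
    TensorProduct.assoc_tmul, lTensor_tmul]
  generalize TensorProduct.assoc k C2 C1 C2 _ = z
  induction z with
  | zero => simp
  | add z w hz hw => simp only [map_add, TensorProduct.tmul_add, hz, hw, mul_add]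
  | tmul p z =>
    induction z with
    | zero => simp
    | add z w hz hw => simp only [map_add, TensorProduct.tmul_add, hz, hw, mul_add]
    | tmul r q => simp [mul_assoc]

omit [Coalgebra k C1] [Coalgebra k C2] in
open LinearMap in
theorem mul_map_middleBraid_right (c : C1 ⊗[k] C2 →ₗ[k] C2 ⊗[k] C1)
    (u : C1 →ₗ[k] E) (v : C2 →ₗ[k] E) (g : C1 ⊗[k] C2 →ₗ[k] E) (s : C1 ⊗[k] C1) (p q : C2) :
    mul' k E (TensorProduct.map g (mul' k E ∘ₗ TensorProduct.map u v)
      (middleBraid c (s ⊗ₜ[k] (p ⊗ₜ[k] q))))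
      = mul' k E (TensorProduct.map g u
        ((TensorProduct.assoc k C1 C2 C1).symm (lTensor C1 c
          (TensorProduct.assoc k C1 C1 C2 (s ⊗ₜ[k] p))))) * v q := by
  induction s with
  | zero => simp
  | add z w hz hw => simp only [map_add, TensorProduct.add_tmul, hz, hw, add_mul]
  | tmul a b =>
    simp only [middleBraid, coe_comp, LinearEquiv.coe_coe, Function.comp_apply,
      TensorProduct.assoc_tmul, TensorProduct.assoc_symm_tmul, lTensor_tmul, rTensor_tmul]
    induction c (b ⊗ₜ[k] p) with
    | zero => simp
    | add z w hz hw =>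
      simp only [map_add, TensorProduct.tmul_add, TensorProduct.add_tmul, hz, hw, add_mul]
    | tmul r d => simp [mul_assoc]

/-- If `u : C1 → E` and `v : C2 → E` are convolution invertible (with convolution inverses
`u'` and `v'`), then `f := μ_E∘(u⊗v) : C1⊗_cC2 → E` is convolution invertible with respect
to the comultiplication `Δ_{C1⊗_cC2} = (id⊗c⊗id)∘(Δ₁⊗Δ₂)` and counit `ε₁⊗ε₂`, with
convolution inverse `g := μ_E∘(v'⊗u')∘c`; explicitly
`μ_E∘(f⊗g)∘Δ_{C1⊗_cC2} = η_E∘(ε₁⊗ε₂) = μ_E∘(g⊗f)∘Δ_{C1⊗_cC2}`. -/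
theorem convInv_mul_tensor (c : C1 ⊗[k] C2 →ₗ[k] C2 ⊗[k] C1)
    (h1 : CompatFirst c) (h2 : CompatSecond c)
    (u u' : C1 →ₗ[k] E) (v v' : C2 →ₗ[k] E)
    (hu : LinearMap.mul' k E ∘ₗ TensorProduct.map u u'
            ∘ₗ (Coalgebra.comul (R := k) (A := C1))
          = Algebra.linearMap k E ∘ₗ (Coalgebra.counit (R := k) (A := C1)))
    (hu' : LinearMap.mul' k E ∘ₗ TensorProduct.map u' u
            ∘ₗ (Coalgebra.comul (R := k) (A := C1))
          = Algebra.linearMap k E ∘ₗ (Coalgebra.counit (R := k) (A := C1)))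
    (hv : LinearMap.mul' k E ∘ₗ TensorProduct.map v v'
            ∘ₗ (Coalgebra.comul (R := k) (A := C2))
          = Algebra.linearMap k E ∘ₗ (Coalgebra.counit (R := k) (A := C2)))
    (hv' : LinearMap.mul' k E ∘ₗ TensorProduct.map v' v
            ∘ₗ (Coalgebra.comul (R := k) (A := C2))
          = Algebra.linearMap k E ∘ₗ (Coalgebra.counit (R := k) (A := C2))) :
    (LinearMap.mul' k E
        ∘ₗ TensorProduct.map (LinearMap.mul' k E ∘ₗ TensorProduct.map u v)
            (LinearMap.mul' k E ∘ₗ TensorProduct.map v' u' ∘ₗ c)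
        ∘ₗ comulD c
      = Algebra.linearMap k E ∘ₗ counitD) ∧
    (LinearMap.mul' k E
        ∘ₗ TensorProduct.map (LinearMap.mul' k E ∘ₗ TensorProduct.map v' u' ∘ₗ c)
            (LinearMap.mul' k E ∘ₗ TensorProduct.map u v)
        ∘ₗ comulD c
      = Algebra.linearMap k E ∘ₗ counitD) := by
  constructor
  · refine TensorProduct.ext' fun x y => ?_
    have hx : LinearMap.mul' k E (TensorProduct.map u u' (Coalgebra.comul (R := k) x))
        = algebraMap k E (Coalgebra.counit (R := k) x) := LinearMap.congr_fun hu x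
    have factor : ∀ s : C1 ⊗[k] C1,
        LinearMap.mul' k E (TensorProduct.map (LinearMap.mul' k E ∘ₗ TensorProduct.map u v)
          (LinearMap.mul' k E ∘ₗ TensorProduct.map v' u' ∘ₗ c)
          (middleBraid c (s ⊗ₜ[k] Coalgebra.comul (R := k) y)))
          = LinearMap.mul' k E (TensorProduct.map u u' s)
            * algebraMap k E (Coalgebra.counit (R := k) y) := by
      intro s
      induction s with
      | zero => simp
      | add z w hz hw => simp only [map_add, TensorProduct.add_tmul, hz, hw, add_mul]
      | tmul a b =>
        rw [mul_map_middleBraid_left, h2.mul_map_comul u' hv]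
        simp [mul_assoc]
    simp only [LinearMap.comp_apply, comulD_tmul, factor, hx]
    simp [counitD]
  · refine TensorProduct.ext' fun x y => ?_
    have hy : LinearMap.mul' k E (TensorProduct.map v' v (Coalgebra.comul (R := k) y))
        = algebraMap k E (Coalgebra.counit (R := k) y) := LinearMap.congr_fun hv' y
    have factor : ∀ t : C2 ⊗[k] C2,
        LinearMap.mul' k E (TensorProduct.map
          (LinearMap.mul' k E ∘ₗ TensorProduct.map v' u' ∘ₗ c)
          (LinearMap.mul' k E ∘ₗ TensorProduct.map u v)
          (middleBraid c (Coalgebra.comul (R := k) x ⊗ₜ[k] t)))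
          = algebraMap k E (Coalgebra.counit (R := k) x)
            * LinearMap.mul' k E (TensorProduct.map v' v t) := by
      intro t
      induction t with
      | zero => simp
      | add z w hz hw => simp only [map_add, TensorProduct.tmul_add, hz, hw, mul_add]
      | tmul p q =>
        rw [mul_map_middleBraid_right, h1.mul_map_comul v' hu']
        simp [mul_assoc]
    simp only [LinearMap.comp_apply, comulD_tmul, factor, hy]
    simp [counitD]
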